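/- If an n-element finite meet-semilattice S has at least 25·2^{n-6} congruences, then S (i.e., its Hasse diagram) is planar. -/

import Mathlib

def IsMeetCong {α : Type*} [SemilatticeInf α] (s : Setoid α) : Prop :=
  ∀ a b c d : α, s.r a b → s.r c d → s.r (a ⊓ c) (b ⊓ d)

noncomputable def numCong (α : Type*) [SemilatticeInf α] : ℕ :=
  Nat.card {s : Setoid α // IsMeetCong s}

def IsUbta {α : Type*} [SemilatticeInf α] [OrderBot α] (x y : α) : Prop :=
  x ≠ ⊥ ∧ y ≠ ⊥ ∧ ¬ x ≤ y ∧ ¬ y ≤ x ∧ ∃ z, x ≤ z ∧ y ≤ z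

def treeCong (α : Type*) [SemilatticeInf α] [OrderBot α] : Setoid α :=
  sInf {s : Setoid α | IsMeetCong s ∧
    ∀ a b v : α, IsUbta a b → IsLUB {a, b} v → s.r (a ⊓ b) v}

def IsNucleus {α : Type*} [SemilatticeInf α] [OrderBot α] (X : Set α) : Prop :=
  (∃ x ∈ X, ∃ y ∈ X, x ≠ y) ∧
  (∀ x ∈ X, ∀ y, y ∈ X ↔ (treeCong α).r x y) ∧
  (∀ a b : α, (treeCong α).r a b → a ≠ b → a ∈ X)

def IsQuasiTree (α : Type*) [SemilatticeInf α] [OrderBot α] : Prop :=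
  ∃ X : Set α, IsNucleus X

/-- The Hasse diagram of a finite order is planar: vertices can be placed at
distinct points of the plane, with strictly increasing height along covers,
and each cover edge drawn as an injective continuous curve so that two distinct
edges meet only at common endpoints. -/
def IsPlanarOrder (α : Type*) [PartialOrder α] : Prop :=
  ∃ (pos : α → ℝ × ℝ) (path : α → α → (ℝ → ℝ × ℝ)),
    Function.Injective pos ∧
    (∀ a b : α, a ⋖ b → (pos a).2 < (pos b).2) ∧
    (∀ a b : α, a ⋖ b →
      ContinuousOn (path a b) (Set.Icc 0 1) ∧
      path a b 0 = pos a ∧ path a b 1 = pos b ∧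
      Set.InjOn (path a b) (Set.Icc 0 1)) ∧
    (∀ a b c d : α, a ⋖ b → c ⋖ d → (a, b) ≠ (c, d) →
      ∀ s ∈ Set.Icc (0 : ℝ) 1, ∀ t ∈ Set.Icc (0 : ℝ) 1,
        path a b s = path c d t →
        path a b s ∈ ({pos a, pos b} ∩ {pos c, pos d} : Set (ℝ × ℝ)))


section Counting

variable {α : Type*} [SemilatticeInf α]

/-- `a` and `b` are incomparable with least upper bound `v`. -/
def IsProperJoin (a b v : α) : Prop :=
  ¬ a ≤ b ∧ ¬ b ≤ a ∧ a ≤ v ∧ b ≤ v ∧ ∀ w, a ≤ w → b ≤ w → v ≤ w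

theorem IsProperJoin.symm {a b v : α} (h : IsProperJoin a b v) : IsProperJoin b a v :=
  ⟨h.2.1, h.1, h.2.2.2.1, h.2.2.1, fun w hb ha => h.2.2.2.2 w ha hb⟩

theorem exists_isProperJoin [Finite α] {a b y : α} (hab : ¬ a ≤ b) (hba : ¬ b ≤ a)
    (hay : a ≤ y) (hby : b ≤ y) : ∃ v, IsProperJoin a b v ∧ v ≤ y := by
  classical
  have := Fintype.ofFinite α
  let U : Finset α := {w | a ≤ w ∧ b ≤ w}
  have hU : U.Nonempty := ⟨y, by simp [U, hay, hby]⟩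
  refine ⟨U.inf' hU id, ⟨hab, hba, ?_, ?_, ?_⟩, ?_⟩
  · exact Finset.le_inf' _ _ fun w hw => (Finset.mem_filter.1 hw).2.1
  · exact Finset.le_inf' _ _ fun w hw => (Finset.mem_filter.1 hw).2.2
  · exact fun w ha hb => Finset.inf'_le id (by simp [U, ha, hb])
  · exact Finset.inf'_le id (by simp [U, hay, hby])

/-- Closure of (the indicator of) a set under bottom and under existing joins. -/
def IsJoinClosed (T : α → Bool) : Prop :=
  (∀ x, (∀ y, x ≤ y) → T x = true) ∧
    ∀ a b v, IsProperJoin a b v → T a = true → T b = true → T v = true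

open Classical in
/-- The indicator of the set of least elements of the classes of a setoid. -/
noncomputable def classMin (s : Setoid α) (x : α) : Bool := decide (∀ y, s.r x y → x ≤ y)

theorem classMin_eq_true {s : Setoid α} {x : α} :
    classMin s x = true ↔ ∀ y, s.r x y → x ≤ y := by
  simp [classMin]

theorem isJoinClosed_classMin {s : Setoid α} (hs : IsMeetCong s) : IsJoinClosed (classMin s) := by
  refine ⟨fun x hx => classMin_eq_true.2 fun y _ => hx y, ?_⟩
  rintro a b v ⟨-, -, hav, hbv, hv⟩ ha hb
  rw [classMin_eq_true] at *
  have key : ∀ {c y}, c ≤ v → (∀ z, s.r c z → c ≤ z) → s.r v y → c ≤ y := by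
    intro c y hcv hc hvy
    have := hs c c v y (s.refl c) hvy
    rw [inf_eq_left.2 hcv] at this
    exact (hc _ this).trans inf_le_right
  exact fun y hy => hv y (key hav ha hy) (key hbv hb hy)

theorem exists_classMin_rel [Finite α] {s : Setoid α} (hs : IsMeetCong s) (x : α) :
    ∃ m, classMin s m = true ∧ s.r x m ∧ m ≤ x := by
  obtain ⟨m, hm⟩ := (Set.toFinite {y | s.r x y}).exists_minimal ⟨x, s.refl x⟩
  have hle : ∀ y, s.r x y → m ≤ y := by
    intro y hy
    have hmy : s.r x (m ⊓ y) := by simpa using hs x m x y hm.1 hy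
    exact (hm.2 hmy inf_le_left).trans inf_le_right
  exact ⟨m, classMin_eq_true.2 fun y hy => hle y (s.trans hm.1 hy), hm.1, hle x (s.refl x)⟩

theorem classMin_injOn [Finite α] {s t : Setoid α} (hs : IsMeetCong s) (ht : IsMeetCong t)
    (h : classMin s = classMin t) : s = t := by
  have key : ∀ {s t : Setoid α}, IsMeetCong s → IsMeetCong t → classMin s = classMin t →
      ∀ {x y}, s.r x y → t.r x y := by
    intro s t hs ht h
    have half : ∀ {x y}, s.r x y → t.r x (x ⊓ y) := by
      intro x y hxy
      obtain ⟨m, hm, hxm, hmx⟩ := exists_classMin_rel ht x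
      have hm' := classMin_eq_true.1 (h ▸ hm)
      have h1 : s.r (m ⊓ x) (m ⊓ y) := hs m m x y (s.refl m) hxy
      rw [inf_eq_left.2 hmx] at h1
      have hmy : m ≤ y := (hm' _ h1).trans inf_le_right
      have h2 : t.r (x ⊓ y) (m ⊓ y) := ht x m y y hxm (t.refl y)
      rw [inf_eq_left.2 hmy] at h2
      exact t.trans hxm (t.symm h2)
    intro x y hxy
    have h2 := half (s.symm hxy)
    rw [inf_comm] at h2
    exact t.trans (half hxy) (t.symm h2)
  exact Setoid.ext fun x y => ⟨key hs ht h, key ht hs h.symm⟩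

theorem numCong_mul_le [Fintype α] {k : ℕ} {e : Fin k → α} (he : Function.Injective e)
    (Q : (Fin k → Bool) → Bool)
    (hQ : ∀ T : α → Bool, IsJoinClosed T → Q (fun i => T (e i)) = true) :
    numCong α * 2 ^ k ≤
      (Finset.univ.filter fun f => Q f = true).card * 2 ^ Fintype.card α := by
  classical
  let F : {s : Setoid α // IsMeetCong s} × (Fin k → Bool) →
      {f : Fin k → Bool // Q f = true} × (α → Bool) := fun p =>
    (⟨fun i => classMin p.1.1 (e i), hQ _ (isJoinClosed_classMin p.1.2)⟩,
      Function.extend e p.2 (classMin p.1.1))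
  have hF : Function.Injective F := by
    rintro ⟨⟨s, hs⟩, f⟩ ⟨⟨t, ht⟩, g⟩ hst
    simp only [F, Prod.mk.injEq, Subtype.mk.injEq] at hst
    obtain ⟨h1, h2⟩ := hst
    have hfg : f = g := by
      funext i
      simpa [he.extend_apply] using congrFun h2 (e i)
    have h3 : classMin s = classMin t := by
      funext x
      by_cases hx : ∃ i, e i = x
      · obtain ⟨i, rfl⟩ := hx
        exact congrFun h1 i
      · simpa [Function.extend_apply' _ _ _ hx] using congrFun h2 x
    obtain rfl := classMin_injOn hs ht h3
    rw [hfg]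
  have := Nat.card_le_card_of_injective F hF
  rw [Nat.card_prod, Nat.card_prod] at this
  simpa [numCong, Fintype.card_subtype] using this

theorem le_card_pattern [Fintype α] (h : 25 * 2 ^ Fintype.card α ≤ 2 ^ 6 * numCong α)
    {k : ℕ} {e : Fin k → α} (he : (List.ofFn e).Nodup) (Q : (Fin k → Bool) → Bool)
    (hQ : ∀ T : α → Bool, IsJoinClosed T → Q (fun i => T (e i)) = true) :
    25 * 2 ^ k ≤ 2 ^ 6 * (Finset.univ.filter fun f => Q f = true).card := by
  have h1 := numCong_mul_le (List.nodup_ofFn.1 he) Q hQ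
  refine Nat.le_of_mul_le_mul_right ?_ (Nat.two_pow_pos (Fintype.card α))
  calc 25 * 2 ^ k * 2 ^ Fintype.card α = 25 * 2 ^ Fintype.card α * 2 ^ k := by ring
    _ ≤ 2 ^ 6 * numCong α * 2 ^ k := Nat.mul_le_mul_right _ h
    _ = 2 ^ 6 * (numCong α * 2 ^ k) := by ring
    _ ≤ _ := by rw [mul_assoc]; exact Nat.mul_le_mul_left _ h1

end Counting

section Critical

variable {α : Type*} [SemilatticeInf α]

theorem IsProperJoin.ne {a b v : α} (h : IsProperJoin a b v) :
    a ≠ b ∧ a ≠ v ∧ b ≠ v := by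
  obtain ⟨h1, h2, h3, h4, -⟩ := h
  exact ⟨fun e => h1 e.le, fun e => h2 (e ▸ h4), fun e => h1 (e ▸ h3)⟩

theorem IsProperJoin.bot_ne {o a b v : α} (ho : ∀ x, o ≤ x) (h : IsProperJoin a b v) :
    o ≠ a ∧ o ≠ b ∧ o ≠ v :=
  ⟨fun e => h.1 (e ▸ ho b), fun e => h.2.1 (e ▸ ho a),
    fun e => h.1 (h.2.2.1.trans (e ▸ ho b))⟩

variable [Fintype α] {o : α}

section SameJoin

variable {a b a' b' v : α}

theorem not_disjoint_joins_of_lt (h : 25 * 2 ^ Fintype.card α ≤ 2 ^ 6 * numCong α)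
    (ho : ∀ x, o ≤ x) (h1 : IsProperJoin a b v) (h2 : IsProperJoin a' b' v)
    (hab' : a ≠ b') (hba' : b ≠ a') (hbb' : b ≠ b') : ¬ a < a' := by
  intro hlt
  have h3 : IsProperJoin a' b v :=
    ⟨fun hle => h1.1 (hlt.le.trans hle),
      fun hle => h2.2.1 (h2.2.2.2.1.trans (h1.2.2.2.2 _ hlt.le hle)),
      h2.2.2.1, h1.2.2.2.1, fun w ha hb => h1.2.2.2.2 w (hlt.le.trans ha) hb⟩
  have := le_card_pattern h (e := ![o, a, b, a', b', v])
    (by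
      have := h1.ne
      have := h2.ne
      have := h1.bot_ne ho
      have := h2.bot_ne ho
      have := hlt.ne
      simp [List.ofFn_succ]
      grind)
    (fun f => f 0 && (!(f 1 && f 2) || f 5) && (!(f 3 && f 4) || f 5) && (!(f 3 && f 2) || f 5)) (by
      intro T hT
      have := hT.1 o ho
      have := hT.2 _ _ _ h1
      have := hT.2 _ _ _ h2
      have := hT.2 _ _ _ h3
      simp
      grind)
  revert this
  decide +kernel

theorem not_disjoint_joins_of_not_le (h : 25 * 2 ^ Fintype.card α ≤ 2 ^ 6 * numCong α)
    (ho : ∀ x, o ≤ x) (h1 : IsProperJoin a b v) (h2 : IsProperJoin a' b' v)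
    (hab' : a ≠ b') (hba' : b ≠ a') (hbb' : b ≠ b') (haa' : ¬ a ≤ a') : a' ≤ a := by
  by_contra ha'a
  obtain ⟨w, h3, hwv⟩ := exists_isProperJoin haa' ha'a h1.2.2.1 h2.2.2.1
  have n1 := h1.ne
  have n2 := h2.ne
  have n3 := h3.ne
  have m1 := h1.bot_ne ho
  have m2 := h2.bot_ne ho
  have m3 := h3.bot_ne ho
  have hbw : b ≠ w := fun e => h1.1 (e ▸ h3.2.2.1)
  have hbw' : b' ≠ w := fun e => h2.1 (e ▸ h3.2.2.2.1)
  by_cases hv : w = v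
  · subst hv
    have := le_card_pattern h (e := ![o, a, b, a', b', w])
      (by simp [List.ofFn_succ]; grind)
      (fun f => f 0 && (!(f 1 && f 2) || f 5) && (!(f 3 && f 4) || f 5) &&
        (!(f 1 && f 3) || f 5)) (by
        intro T hT
        have := hT.1 o ho
        have := hT.2 _ _ _ h1
        have := hT.2 _ _ _ h2
        have := hT.2 _ _ _ h3
        simp
        grind)
    revert this
    decide +kernel
  · have := le_card_pattern h (e := ![o, a, b, a', b', v, w])
      (by simp [List.ofFn_succ]; grind)
      (fun f => f 0 && (!(f 1 && f 2) || f 5) && (!(f 3 && f 4) || f 5) &&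
        (!(f 1 && f 3) || f 6)) (by
        intro T hT
        have := hT.1 o ho
        have := hT.2 _ _ _ h1
        have := hT.2 _ _ _ h2
        have := hT.2 _ _ _ h3
        simp
        grind)
    revert this
    decide +kernel

end SameJoin

theorem ne_of_joins_of_disjoint {a b v a' b' v' : α}
    (h : 25 * 2 ^ Fintype.card α ≤ 2 ^ 6 * numCong α)
    (ho : ∀ x, o ≤ x) (h1 : IsProperJoin a b v) (h2 : IsProperJoin a' b' v')
    (hab' : a ≠ b') (hba' : b ≠ a') (hbb' : b ≠ b') : v ≠ a' := by
  rintro rfl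
  have n1 := h1.ne
  have n2 := h2.ne
  have m1 := h1.bot_ne ho
  have m2 := h2.bot_ne ho
  have hav : a ≠ v' := fun e => h1.2.1 (h1.2.2.2.1.trans (e ▸ h2.2.2.1))
  have hbv : b ≠ v' := fun e => h1.1 (h1.2.2.1.trans (e ▸ h2.2.2.1))
  have := le_card_pattern h (e := ![o, a, b, v, b', v'])
    (by simp [List.ofFn_succ]; grind)
    (fun f => f 0 && (!(f 1 && f 2) || f 3) && (!(f 3 && f 4) || f 5)) (by
      intro T hT
      have := hT.1 o ho
      have := hT.2 _ _ _ h1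
      have := hT.2 _ _ _ h2
      simp
      grind)
  revert this
  decide +kernel

/-- Any two incomparable bounded pairs meet. -/
theorem joins_not_disjoint {a b v a' b' v' : α}
    (h : 25 * 2 ^ Fintype.card α ≤ 2 ^ 6 * numCong α)
    (ho : ∀ x, o ≤ x) (h1 : IsProperJoin a b v) (h2 : IsProperJoin a' b' v') :
    a = a' ∨ a = b' ∨ b = a' ∨ b = b' := by
  by_contra! hne
  obtain ⟨haa', hab', hba', hbb'⟩ := hne
  by_cases hv : v = v'
  · subst hv
    rcases em (a ≤ a') with hle | hle
    · exact not_disjoint_joins_of_lt h ho h1 h2 hab' hba' hbb' (lt_of_le_of_ne hle haa')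
    · exact not_disjoint_joins_of_lt h ho h2 h1 hba'.symm hab'.symm hbb'.symm
        (lt_of_le_of_ne (not_disjoint_joins_of_not_le h ho h1 h2 hab' hba' hbb' hle) haa'.symm)
  have e1 := ne_of_joins_of_disjoint h ho h1 h2 hab' hba' hbb'
  have e2 := ne_of_joins_of_disjoint h ho h1 h2.symm haa' hbb' hba'
  have e3 := ne_of_joins_of_disjoint h ho h2 h1 hba'.symm hab'.symm hbb'.symm
  have e4 := ne_of_joins_of_disjoint h ho h2 h1.symm haa'.symm hbb'.symm hab'.symm
  have n1 := h1.ne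
  have n2 := h2.ne
  have m1 := h1.bot_ne ho
  have m2 := h2.bot_ne ho
  have := le_card_pattern h (e := ![o, a, b, v, a', b', v'])
    (by simp [List.ofFn_succ]; grind)
    (fun f => f 0 && (!(f 1 && f 2) || f 3) && (!(f 4 && f 5) || f 6)) (by
      intro T hT
      have := hT.1 o ho
      have := hT.2 _ _ _ h1
      have := hT.2 _ _ _ h2
      simp
      grind)
  revert this
  decide +kernel

theorem triangle_joins_ne {a b c d f : α}
    (h : 25 * 2 ^ Fintype.card α ≤ 2 ^ 6 * numCong α)
    (ho : ∀ x, o ≤ x) (h1 : IsProperJoin a b d) (h2 : IsProperJoin a c d)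
    (h3 : IsProperJoin b c f) : False := by
  have n1 := h1.ne
  have n2 := h2.ne
  have n3 := h3.ne
  have m1 := h1.bot_ne ho
  have m2 := h2.bot_ne ho
  have m3 := h3.bot_ne ho
  by_cases hdf : d = f
  · subst hdf
    have := le_card_pattern h (e := ![o, a, b, c, d])
      (by simp [List.ofFn_succ]; grind)
      (fun f => f 0 && (!(f 1 && f 2) || f 4) && (!(f 1 && f 3) || f 4) &&
        (!(f 2 && f 3) || f 4)) (by
        intro T hT
        have := hT.1 o ho
        have := hT.2 _ _ _ h1
        have := hT.2 _ _ _ h2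
        have := hT.2 _ _ _ h3
        simp
        grind)
    revert this
    decide +kernel
  · have haf : a ≠ f := fun e => h1.2.1 (e ▸ h3.2.2.1)
    have := le_card_pattern h (e := ![o, a, b, c, d, f])
      (by simp [List.ofFn_succ]; grind)
      (fun f => f 0 && (!(f 1 && f 2) || f 4) && (!(f 1 && f 3) || f 4) &&
        (!(f 2 && f 3) || f 5)) (by
        intro T hT
        have := hT.1 o ho
        have := hT.2 _ _ _ h1
        have := hT.2 _ _ _ h2
        have := hT.2 _ _ _ h3
        simp
        grind)
    revert this
    decide +kernel

/-- No three elements are pairwise incomparable and pairwise bounded. -/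
theorem not_triangle_joins {a b c d e f : α}
    (h : 25 * 2 ^ Fintype.card α ≤ 2 ^ 6 * numCong α)
    (ho : ∀ x, o ≤ x) (h1 : IsProperJoin a b d) (h2 : IsProperJoin a c e)
    (h3 : IsProperJoin b c f) : False := by
  by_cases hde : d = e
  · subst hde
    exact triangle_joins_ne h ho h1 h2 h3
  by_cases hdf : d = f
  · subst hdf
    exact triangle_joins_ne h ho h1.symm h3 h2
  by_cases hef : e = f
  · subst hef
    exact triangle_joins_ne h ho h2.symm h3.symm h1
  have n1 := h1.ne
  have n2 := h2.ne
  have n3 := h3.ne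
  have m1 := h1.bot_ne ho
  have m2 := h2.bot_ne ho
  have m3 := h3.bot_ne ho
  have haf : a ≠ f := fun e => h1.2.1 (e ▸ h3.2.2.1)
  have hbe : b ≠ e := fun e => h1.1 (e ▸ h2.2.2.1)
  have hcd : c ≠ d := fun e => h2.1 (e ▸ h1.2.2.1)
  have := le_card_pattern h (e := ![o, a, b, c, d, e, f])
    (by simp [List.ofFn_succ]; grind)
    (fun f => f 0 && (!(f 1 && f 2) || f 4) && (!(f 1 && f 3) || f 5) &&
      (!(f 2 && f 3) || f 6)) (by
      intro T hT
      have := hT.1 o ho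
      have := hT.2 _ _ _ h1
      have := hT.2 _ _ _ h2
      have := hT.2 _ _ _ h3
      simp
      grind)
  revert this
  decide +kernel

theorem star_joins_ne {c b b' x v v' : α}
    (h : 25 * 2 ^ Fintype.card α ≤ 2 ^ 6 * numCong α)
    (ho : ∀ x, o ≤ x) (h1 : IsProperJoin c b v) (h2 : IsProperJoin c b' v')
    (h3 : IsProperJoin c x v) (hv : v ≠ v') (hbb' : b ≠ b') (hbx : b ≠ x) : b' = x := by
  by_contra hb'x
  have n1 := h1.ne
  have n2 := h2.ne
  have n3 := h3.ne
  have m1 := h1.bot_ne ho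
  have m2 := h2.bot_ne ho
  have m3 := h3.bot_ne ho
  have e1 : b ≠ v' := fun e => h1.1 (e ▸ h2.2.2.1)
  have e2 : b' ≠ v := fun e => h2.1 (e ▸ h1.2.2.1)
  have e3 : x ≠ v' := fun e => h3.1 (e ▸ h2.2.2.1)
  have := le_card_pattern h (e := ![o, c, b, b', x, v, v'])
    (by simp [List.ofFn_succ]; grind)
    (fun f => f 0 && (!(f 1 && f 2) || f 5) && (!(f 1 && f 3) || f 6) &&
      (!(f 1 && f 4) || f 5)) (by
      intro T hT
      have := hT.1 o ho
      have := hT.2 _ _ _ h1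
      have := hT.2 _ _ _ h2
      have := hT.2 _ _ _ h3
      simp
      grind)
  revert this
  decide +kernel

/-- If two joins with `c` differ, then there are no further joins with `c`. -/
theorem eq_or_eq_of_joins {c b b' x v v' w : α}
    (h : 25 * 2 ^ Fintype.card α ≤ 2 ^ 6 * numCong α)
    (ho : ∀ x, o ≤ x) (h1 : IsProperJoin c b v) (h2 : IsProperJoin c b' v')
    (h3 : IsProperJoin c x w) (hv : v ≠ v') : x = b ∨ x = b' := by
  by_contra! hx
  obtain ⟨hxb, hxb'⟩ := hx
  have hbb' : b ≠ b' := by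
    rintro rfl
    exact hv (le_antisymm (h1.2.2.2.2 _ h2.2.2.1 h2.2.2.2.1) (h2.2.2.2.2 _ h1.2.2.1 h1.2.2.2.1))
  by_cases hw : w = v
  · subst hw
    exact hxb' (star_joins_ne h ho h1 h2 h3 hv hbb' hxb.symm).symm
  by_cases hw' : w = v'
  · subst hw'
    exact hxb (star_joins_ne h ho h2 h1 h3 hv.symm hbb'.symm hxb'.symm).symm
  have n1 := h1.ne
  have n2 := h2.ne
  have n3 := h3.ne
  have m1 := h1.bot_ne ho
  have m2 := h2.bot_ne ho
  have m3 := h3.bot_ne ho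
  have e1 : b ≠ v' := fun e => h1.1 (e ▸ h2.2.2.1)
  have e2 : b' ≠ v := fun e => h2.1 (e ▸ h1.2.2.1)
  have e3 : x ≠ v' := fun e => h3.1 (e ▸ h2.2.2.1)
  have e4 : x ≠ v := fun e => h3.1 (e ▸ h1.2.2.1)
  have e5 : b ≠ w := fun e => h1.1 (e ▸ h3.2.2.1)
  have e6 : b' ≠ w := fun e => h2.1 (e ▸ h3.2.2.1)
  have := le_card_pattern h (e := ![o, c, b, b', x, v, v', w])
    (by simp [List.ofFn_succ]; grind)
    (fun f => f 0 && (!(f 1 && f 2) || f 5) && (!(f 1 && f 3) || f 6) &&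
      (!(f 1 && f 4) || f 7)) (by
      intro T hT
      have := hT.1 o ho
      have := hT.2 _ _ _ h1
      have := hT.2 _ _ _ h2
      have := hT.2 _ _ _ h3
      simp
      grind)
  revert this
  decide +kernel

end Critical

section Separation

variable {α : Type*}

/-- `L` is (the rank function of) a linear extension of `A` such that an element lying between
the members of a pair `x < y` is comparable, on the appropriate side, with `x` or with `y`. -/
structure IsNonseparating [PartialOrder α] (A : Set α) (L : α → ℝ) : Prop where
  injOn : Set.InjOn L A
  strictMonoOn : StrictMonoOn L A
  lt_or_lt : ∀ x ∈ A, ∀ y ∈ A, ∀ z ∈ A, x < y → L x < L z → L z < L y → x < z ∨ z < y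

theorem exists_cut [Finite α] (A : Set α) (L : α → ℝ) (U : α → Prop)
    (hU : ∀ x ∈ A, ∀ y ∈ A, ¬ U x → U y → L x < L y) :
    ∃ t, ∀ x ∈ A, (U x → t < L x) ∧ (¬ U x → L x < t) := by
  classical
  have := Fintype.ofFinite α
  obtain ⟨t, h1, h2⟩ := Order.exists_between_finsets
    (lo := (Finset.univ.filter fun x => x ∈ A ∧ ¬ U x).image L)
    (hi := (Finset.univ.filter fun x => x ∈ A ∧ U x).image L) (by
      simp only [Finset.mem_image, Finset.mem_filter, Finset.mem_univ, true_and]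
      rintro _ ⟨x, ⟨hx, hux⟩, rfl⟩ _ ⟨y, ⟨hy, huy⟩, rfl⟩
      exact hU x hx y hy hux huy)
  refine ⟨t, fun x hx => ⟨fun hu => h2 _ ?_, fun hu => h1 _ ?_⟩⟩ <;>
  exact Finset.mem_image_of_mem _ (by simp [hx, hu])

theorem IsNonseparating.insert_leaf [PartialOrder α] {A : Set α} {L : α → ℝ} {m p : α} {t : ℝ}
    (hL : IsNonseparating (A \ {m}) L) (hm : ∀ x ∈ A, ¬ m < x) (hp : p ∈ A) (hpm : p < m)
    (hlt : ∀ x, x < m → x ≤ p) (ht : ∀ x ∈ A \ {m}, L x ≠ t) (hpt : L p < t)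
    (h1 : ∀ z ∈ A \ {m}, L p < L z → L z < t → p < z)
    (h2 : ∀ x ∈ A \ {m}, ∀ y ∈ A \ {m}, x < y → L x < t → t < L y → x ≤ p) :
    ∃ L', IsNonseparating A L' := by
  classical
  have hp' : p ∈ A \ {m} := ⟨hp, hpm.ne⟩
  have hmono : ∀ x ∈ A \ {m}, x ≤ p → L x ≤ L p := fun x hx hxp =>
    hL.strictMonoOn.monotoneOn hx hp' hxp
  refine ⟨Function.update L m t, ?_, ?_, ?_⟩
  · intro x hx y hy hxy
    by_cases hxm : x = m <;> by_cases hym : y = m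
    · rw [hxm, hym]
    · subst hxm
      rw [Function.update_self, Function.update_of_ne hym] at hxy
      exact absurd hxy.symm (ht y ⟨hy, hym⟩)
    · subst hym
      rw [Function.update_self, Function.update_of_ne hxm] at hxy
      exact absurd hxy (ht x ⟨hx, hxm⟩)
    · rw [Function.update_of_ne hym, Function.update_of_ne hxm] at hxy
      exact hL.injOn ⟨hx, hxm⟩ ⟨hy, hym⟩ hxy
  · intro x hx y hy hxy
    have hxm : x ≠ m := fun e => hm y hy (e ▸ hxy)
    rw [Function.update_of_ne hxm]
    by_cases hym : y = m
    · subst hym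
      rw [Function.update_self]
      exact (hmono x ⟨hx, hxm⟩ (hlt x hxy)).trans_lt hpt
    · rw [Function.update_of_ne hym]
      exact hL.strictMonoOn ⟨hx, hxm⟩ ⟨hy, hym⟩ hxy
  · intro x hx y hy z hz hxy
    have hxm : x ≠ m := fun e => hm y hy (e ▸ hxy)
    rw [Function.update_of_ne hxm]
    by_cases hzm : z = m
    · subst hzm
      by_cases hyz : y = z
      · subst hyz
        exact fun _ h => absurd h (lt_irrefl _)
      rw [Function.update_self, Function.update_of_ne hyz]
      exact fun ha hb => Or.inl ((h2 x ⟨hx, hxm⟩ y ⟨hy, hyz⟩ hxy ha hb).trans_lt hpm)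
    rw [Function.update_of_ne hzm]
    by_cases hym : y = m
    · subst hym
      rw [Function.update_self]
      intro ha hb
      have hxp := hlt x hxy
      rcases lt_trichotomy (L z) (L p) with hzp | hzp | hzp
      · have hxp' : x < p := lt_of_le_of_ne hxp (by rintro rfl; exact lt_asymm ha hzp)
        exact (hL.lt_or_lt x ⟨hx, hxm⟩ p hp' z ⟨hz, hzm⟩ hxp' ha hzp).imp_right
          fun h => h.trans hpm
      · exact Or.inr (hL.injOn ⟨hz, hzm⟩ hp' hzp ▸ hpm)
      · exact Or.inl (hxp.trans_lt (h1 z ⟨hz, hzm⟩ hzp hb))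
    · rw [Function.update_of_ne hym]
      exact hL.lt_or_lt x ⟨hx, hxm⟩ y ⟨hy, hym⟩ z ⟨hz, hzm⟩ hxy

/-- If every incomparable pair below `v` contains `c`, then the elements below `v` form a chain
together with `c`, and `c` can be placed after all the elements incomparable with it. -/
theorem exists_isNonseparating_Iic [PartialOrder α] [Finite α] {v c : α}
    (hc : ∀ x ≤ v, ∀ y ≤ v, x ≠ c → y ≠ c → x ≤ y ∨ y ≤ x) :
    ∃ L, IsNonseparating (Set.Iic v) L ∧ ∀ b ≤ v, ¬ c ≤ b → L b < L c := by
  classical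
  have := Fintype.ofFinite α
  let h : α → ℕ := fun x => (Finset.univ.filter fun y => y ≤ x ∧ y ≠ c).card
  let K : ℕ := (Finset.univ.filter fun y => y ≤ v ∧ y ≠ c ∧ ¬ c ≤ y).card
  let L : α → ℕ := fun x => if x = c then 2 * K + 1 else 2 * h x
  have hcc : L c = 2 * K + 1 := if_pos rfl
  have hx : ∀ {x}, x ≠ c → L x = 2 * h x := fun hx => if_neg hx
  have hlt : ∀ {x}, x ≤ v → ¬ c ≤ x → L x < L c := by
    intro x hxv hcx
    have hxc : x ≠ c := fun e => hcx e.ge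
    have : h x ≤ K := by
      refine Finset.card_le_card fun y hy => ?_
      simp only [Finset.mem_filter, Finset.mem_univ, true_and] at hy ⊢
      exact ⟨hy.1.trans hxv, hy.2, fun hcy => hcx (hcy.trans hy.1)⟩
    rw [hx hxc, hcc]
    omega
  have hgt : ∀ {x}, x ≤ v → c < x → L c < L x := by
    intro x hxv hcx
    have : K < h x := by
      refine Finset.card_lt_card (Finset.ssubset_iff_of_subset ?_ |>.2 ⟨x, ?_, ?_⟩)
      · intro y hy
        simp only [Finset.mem_filter, Finset.mem_univ, true_and] at hy ⊢
        refine ⟨(hc y hy.1 x hxv hy.2.1 hcx.ne').resolve_right fun hxy => ?_, hy.2.1⟩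
        exact hy.2.2 (hcx.le.trans hxy)
      · simp [hcx.ne']
      · simp [hcx.le]
    rw [hx hcx.ne', hcc]
    omega
  have hmono : ∀ {x y}, x ≠ c → y ≠ c → x < y → L x < L y := by
    intro x y hxc hyc hxy
    have : h x < h y := by
      refine Finset.card_lt_card (Finset.ssubset_iff_of_subset ?_ |>.2 ⟨y, ?_, ?_⟩)
      · intro w hw
        simp only [Finset.mem_filter, Finset.mem_univ, true_and] at hw ⊢
        exact ⟨hw.1.trans hxy.le, hw.2⟩
      · simp [hyc]
      · simp [hxy.not_ge]
    rw [hx hxc, hx hyc]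
    omega
  have hcmp : ∀ {x y}, x ≤ v → y ≤ v → x ≠ c → y ≠ c → L x < L y → x < y := by
    intro x y hxv hyv hxc hyc hL
    rcases hc x hxv y hyv hxc hyc with hle | hle
    · exact lt_of_le_of_ne hle (by rintro rfl; exact lt_irrefl _ hL)
    · rcases hle.eq_or_lt with rfl | hlt'
      · exact absurd hL (lt_irrefl _)
      · exact absurd hL (hmono hyc hxc hlt').asymm
  have hltc : ∀ {x}, x ≤ v → L c < L x → c < x := by
    intro x hxv hL
    have : c ≤ x := by
      by_contra hcx
      exact lt_asymm hL (hlt hxv hcx)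
    exact lt_of_le_of_ne this (by rintro rfl; exact lt_irrefl _ hL)
  refine ⟨fun x => (L x : ℝ), ⟨?_, ?_, ?_⟩, fun b hb hcb => Nat.cast_lt.2 (hlt hb hcb)⟩
  · intro x hxv y hyv hxy
    have hxy : L x = L y := Nat.cast_injective hxy
    by_contra hne
    by_cases hxc : x = c
    · subst hxc
      by_cases hcy : x ≤ y
      · exact (hgt hyv (lt_of_le_of_ne hcy hne)).ne hxy
      · exact (hlt hyv hcy).ne hxy.symm
    by_cases hyc : y = c
    · subst hyc
      by_cases hcx : y ≤ x
      · exact (hgt hxv (lt_of_le_of_ne' hcx hne)).ne hxy.symm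
      · exact (hlt hxv hcx).ne hxy
    rcases hc x hxv y hyv hxc hyc with hle | hle
    · exact (hmono hxc hyc (lt_of_le_of_ne hle hne)).ne hxy
    · exact (hmono hyc hxc (lt_of_le_of_ne' hle hne)).ne hxy.symm
  · intro x hxv y hyv hxy
    have : L x < L y := by
      by_cases hxc : x = c
      · subst hxc
        exact hgt hyv hxy
      by_cases hyc : y = c
      · subst hyc
        exact hlt hxv hxy.not_ge
      exact hmono hxc hyc hxy
    exact Nat.cast_lt.2 this
  · intro x hxv y hyv z hzv hxy hxz hzy
    have hxz : L x < L z := Nat.cast_lt.1 hxz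
    have hzy : L z < L y := Nat.cast_lt.1 hzy
    by_cases hzc : z = c
    · subst hzc
      exact Or.inr (hltc hyv hzy)
    by_cases hxc : x = c
    · subst hxc
      exact Or.inl (hltc hzv hxz)
    exact Or.inl (hcmp hxv hzv hxc hzc hxz)

end Separation

section Drawing

variable {α : Type*}

theorem exists_realizer [PartialOrder α] [Finite α] {L : α → ℝ}
    (hL : IsNonseparating Set.univ L) :
    ∃ g : α → ℝ, StrictMono g ∧ ∀ x y, L x ≤ L y → g x ≤ g y → x ≤ y := by
  classical
  have := Fintype.ofFinite α
  have hinj : Function.Injective L := fun x y hxy => hL.injOn trivial trivial hxy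
  have hmono : ∀ {x y}, x < y → L x < L y := fun h => hL.strictMonoOn trivial trivial h
  have hsep : ∀ {x y z}, x < y → L x < L z → L z < L y → x < z ∨ z < y := fun {x y z} h =>
    hL.lt_or_lt x trivial y trivial z trivial h
  let R : α → α → Prop := fun x y => x < y ∨ (¬ x ≤ y ∧ ¬ y ≤ x ∧ L y < L x)
  have hirr : ∀ x, ¬ R x x := by
    rintro x (h | h)
    · exact lt_irrefl _ h
    · exact h.1 le_rfl
  have htrans : ∀ {x y z}, R x y → R y z → R x z := by
    rintro x y z (hxy | ⟨hxy, hyx, hL1⟩) (hyz | ⟨hyz, hzy, hL2⟩)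
    · exact Or.inl (hxy.trans hyz)
    · by_cases hxz : x ≤ z
      · exact Or.inl (lt_of_le_of_ne hxz fun e => hzy (e ▸ hxy.le))
      have hzx : ¬ z ≤ x := fun h => hzy (h.trans hxy.le)
      refine Or.inr ⟨hxz, hzx, lt_of_not_ge fun h => ?_⟩
      rcases hsep hxy (lt_of_le_of_ne h fun e => hxz (hinj e).le) hL2 with h' | h'
      exacts [hxz h'.le, hzy h'.le]
    · by_cases hxz : x ≤ z
      · exact Or.inl (lt_of_le_of_ne hxz fun e => hyx (e ▸ hyz.le))
      have hzx : ¬ z ≤ x := fun h => hyx (hyz.le.trans h)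
      refine Or.inr ⟨hxz, hzx, lt_of_not_ge fun h => ?_⟩
      rcases hsep hyz hL1 (lt_of_le_of_ne h fun e => hxz (hinj e).le) with h' | h'
      exacts [hyx h'.le, hxz h'.le]
    · have hzx' := hL2.trans hL1
      have hxz : ¬ x ≤ z := fun h => by
        rcases h.eq_or_lt with rfl | h
        exacts [lt_irrefl _ hzx', lt_asymm hzx' (hmono h)]
      refine Or.inr ⟨hxz, fun h => ?_, hzx'⟩
      rcases hsep (lt_of_le_of_ne h fun e => hxz e.ge) hL2 hL1 with h' | h'
      exacts [hzy h'.le, hyx h'.le]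
  let g : α → ℕ := fun y => (Finset.univ.filter fun x => R x y).card
  have hg : ∀ {x y}, R x y → g x < g y := by
    intro x y hxy
    refine Finset.card_lt_card (Finset.ssubset_iff_of_subset ?_ |>.2 ⟨x, ?_, ?_⟩)
    · intro w hw
      simp only [Finset.mem_filter, Finset.mem_univ, true_and] at hw ⊢
      exact htrans hw hxy
    · simpa using hxy
    · simpa using hirr x
  refine ⟨fun x => (g x : ℝ), fun x y hxy => Nat.cast_lt.2 (hg (Or.inl hxy)), ?_⟩
  intro x y h1 h2
  have h2 : g x ≤ g y := Nat.cast_le.1 h2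
  by_contra hxy
  by_cases hyx : y ≤ x
  · exact (hmono (lt_of_le_of_ne hyx fun e => hxy e.ge)).not_ge h1
  · exact (hg (Or.inr ⟨hyx, hxy, lt_of_le_of_ne h1 fun e => hxy (hinj e).le⟩)).not_ge h2

/-- Two segments issuing from a common point which meet elsewhere point in the same direction. -/
theorem le_of_segments_meet {a b d s t : ℝ} (hs : 0 < s) (hst : s ≤ t) (hab : a ≤ b)
    (h : (1 - s) * a + s * b = (1 - t) * a + t * d) : d ≤ b := by
  have h1 : t * (d - a) = s * (b - a) := by linarith
  have h2 : s * (b - a) ≤ t * (b - a) := mul_le_mul_of_nonneg_right hst (by linarith)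
  have h3 : t * (d - a) ≤ t * (b - a) := h1 ▸ h2
  linarith [le_of_mul_le_mul_left h3 (hs.trans_le hst)]

theorem isPlanarOrder_of_realizer [SemilatticeInf α] {f g : α → ℝ}
    (hinj : Function.Injective f) (hf : StrictMono f) (hg : StrictMono g)
    (hfg : ∀ x y, f x ≤ f y → g x ≤ g y → x ≤ y) : IsPlanarOrder α := by
  refine ⟨fun a => (f a, g a), fun a b t => ((1 - t) * f a + t * f b, (1 - t) * g a + t * g b),
    fun x y h => hinj (Prod.mk.inj h).1, fun a b hab => hg hab.lt, ?_, ?_⟩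
  · intro a b hab
    refine ⟨by fun_prop, by simp, by simp, fun s _ t _ hst => ?_⟩
    have h1 : (1 - s) * f a + s * f b = (1 - t) * f a + t * f b := (Prod.mk.inj hst).1
    have h2 : (s - t) * (f b - f a) = 0 := by linarith
    rcases mul_eq_zero.1 h2 with h | h
    · linarith
    · linarith [hf hab.lt]
  · rintro a b c d hab hcd hne s ⟨hs0, hs1⟩ t ⟨ht0, ht1⟩ hst
    obtain ⟨e1, e2⟩ := Prod.mk.inj hst
    have fab := hf hab.lt
    have fcd := hf hcd.lt
    have gab := hg hab.lt
    have gcd := hg hcd.lt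
    have had : a ≤ d := hfg a d (by nlinarith) (by nlinarith)
    have hcb : c ≤ b := hfg c b (by nlinarith) (by nlinarith)
    rcases hab.eq_or_eq (le_inf hab.le had) inf_le_left with h1 | h1 <;>
    rcases hcd.eq_or_eq (le_inf hcb hcd.le) inf_le_right with h2 | h2
    · obtain rfl : a = c := h1.symm.trans h2
      rcases hs0.eq_or_lt with rfl | hs0
      · simp
      rcases ht0.eq_or_lt with rfl | ht0
      · simp [e1, e2]
      exfalso
      apply hne
      rcases le_total s t with hle | hle
      · have hdb := hfg d b (le_of_segments_meet hs0 hle fab.le e1)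
          (le_of_segments_meet hs0 hle gab.le e2)
        rcases hab.eq_or_eq hcd.le hdb with h | h
        · exact absurd h hcd.lt.ne'
        · rw [h]
      · have hbd := hfg b d (le_of_segments_meet ht0 hle fcd.le e1.symm)
          (le_of_segments_meet ht0 hle gcd.le e2.symm)
        rcases hcd.eq_or_eq hab.le hbd with h | h
        · exact absurd h hab.lt.ne'
        · rw [h]
    · obtain rfl : a = d := h1.symm.trans h2
      have : s * (f b - f a) + (1 - t) * (f a - f c) = 0 := by linarith
      have hs : s = 0 := by nlinarith
      subst hs
      simp
    · obtain rfl : b = c := h1.symm.trans h2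
      have hs : s = 1 := by nlinarith
      subst hs
      simp
    · obtain rfl : b = d := h1.symm.trans h2
      rcases hs1.eq_or_lt with rfl | hs1
      · simp
      rcases ht1.eq_or_lt with rfl | ht1
      · simp [e1, e2]
      exfalso
      apply hne
      rcases le_total s t with hle | hle
      · have hca := hfg c a
          (neg_le_neg_iff.1 (le_of_segments_meet (a := -f b) (s := 1 - t) (t := 1 - s)
            (by linarith) (by linarith) (by linarith) (by linarith)))
          (neg_le_neg_iff.1 (le_of_segments_meet (a := -g b) (s := 1 - t) (t := 1 - s)
            (by linarith) (by linarith) (by linarith) (by linarith)))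
        rcases hcd.eq_or_eq hca hab.le with h | h
        · rw [h]
        · exact absurd h hab.lt.ne
      · have hac := hfg a c
          (neg_le_neg_iff.1 (le_of_segments_meet (a := -f b) (s := 1 - s) (t := 1 - t)
            (by linarith) (by linarith) (by linarith) (by linarith)))
          (neg_le_neg_iff.1 (le_of_segments_meet (a := -g b) (s := 1 - s) (t := 1 - t)
            (by linarith) (by linarith) (by linarith) (by linarith)))
        rcases hab.eq_or_eq hac hcd.le with h | h
        · rw [h]
        · exact absurd h hcd.lt.ne

end Drawing

section ManyCongruences

variable {α : Type*} [SemilatticeInf α] [Fintype α] {o : α}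

theorem exists_mem_of_isProperJoin (h : 25 * 2 ^ Fintype.card α ≤ 2 ^ 6 * numCong α)
    (ho : ∀ x, o ≤ x) {a b v : α} (hab : IsProperJoin a b v) :
    ∃ c : α, ∀ x y w, IsProperJoin x y w → x = c ∨ y = c := by
  by_cases ha : ∀ x y w, IsProperJoin x y w → x = a ∨ y = a
  · exact ⟨a, ha⟩
  obtain ⟨y, w, hby, hya⟩ : ∃ y w, IsProperJoin b y w ∧ y ≠ a := by
    push Not at ha
    obtain ⟨x, y, w, hxy, hx, hy⟩ := ha
    rcases joins_not_disjoint h ho hab hxy with e | e | e | e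
    exacts [absurd e.symm hx, absurd e.symm hy, ⟨y, w, e ▸ hxy, hy⟩, ⟨x, w, e ▸ hxy.symm, hx⟩]
  refine ⟨b, fun x' y' w' hxy' => ?_⟩
  by_contra! hb
  have hay : ∀ w, ¬ IsProperJoin a y w := fun w h' => not_triangle_joins h ho hab h' hby
  rcases joins_not_disjoint h ho hab hxy' with e | e | e | e
  · rcases joins_not_disjoint h ho hby hxy' with e' | e' | e' | e'
    exacts [hb.1 e'.symm, hb.2 e'.symm, hya (e'.trans e.symm), hay w' (e ▸ e' ▸ hxy')]
  · rcases joins_not_disjoint h ho hby hxy' with e' | e' | e' | e'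
    exacts [hb.1 e'.symm, hb.2 e'.symm, hay w' (e ▸ e' ▸ hxy'.symm), hya (e'.trans e.symm)]
  · exact hb.1 e.symm
  · exact hb.2 e.symm

theorem exists_isNonseparating_of_leaf (h : 25 * 2 ^ Fintype.card α ≤ 2 ^ 6 * numCong α)
    (ho : ∀ x, o ≤ x) {A : Set α} {L : α → ℝ} {m p : α}
    (hL : IsNonseparating (A \ {m}) L) (hm : ∀ x ∈ A, ¬ m < x) (hp : p ∈ A) (hpm : p < m)
    (hlt : ∀ x, x < m → x ≤ p) : ∃ L', IsNonseparating A L' := by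
  have hp' : p ∈ A \ {m} := ⟨hp, hpm.ne⟩
  have hnle : ∀ {x y}, x ∈ A \ {m} → y ∈ A \ {m} → L x < L y → ¬ y ≤ x := fun hx hy hxy hyx =>
    (hL.strictMonoOn.monotoneOn hy hx hyx).not_gt hxy
  by_cases hcase : ∃ x₀ ∈ A \ {m}, L x₀ < L p ∧ ¬ x₀ ≤ p ∧ ∃ y ∈ A \ {m}, x₀ ≤ y ∧ p ≤ y
  · obtain ⟨x₀, hx₀, hx₀p, hnx₀, y₀, -, hxy₀, hpy₀⟩ := hcase
    obtain ⟨v₀, hv₀, -⟩ := exists_isProperJoin hnx₀ (hnle hx₀ hp' hx₀p) hxy₀ hpy₀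
    obtain ⟨t, ht⟩ := exists_cut (A \ {m}) L
      (fun w => ∃ z ∈ A \ {m}, L p < L z ∧ ¬ p < z ∧ L z ≤ L w) (by
        rintro x - y - hx ⟨z, hz, h1, h2, h3⟩
        by_contra hxy
        exact hx ⟨z, hz, h1, h2, h3.trans (not_lt.1 hxy)⟩)
    have hpt : L p < t := (ht p hp').2 fun ⟨z, _, h1, _, h3⟩ => h1.not_ge h3
    refine hL.insert_leaf hm hp hpm hlt ?_ hpt ?_ ?_
    · intro x hx e
      have := ht x hx
      rw [e] at this
      exact (em _).elim (fun hu => lt_irrefl _ (this.1 hu)) (fun hu => lt_irrefl _ (this.2 hu))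
    · intro z hz hpz hzt
      by_contra hnpz
      exact lt_asymm hzt ((ht z hz).1 ⟨z, hz, hpz, hnpz, le_rfl⟩)
    · intro x hx y hy hxy hxt hty
      have hUx : ¬ ∃ z ∈ A \ {m}, L p < L z ∧ ¬ p < z ∧ L z ≤ L x := fun hu =>
        lt_asymm hxt ((ht x hx).1 hu)
      have hUy : ∃ z ∈ A \ {m}, L p < L z ∧ ¬ p < z ∧ L z ≤ L y := by
        by_contra hu
        exact lt_asymm hty ((ht y hy).2 hu)
      obtain ⟨z, hz, hpz, hnpz, hzy⟩ := hUy
      have hxz : L x < L z := lt_of_not_ge fun hzx => hUx ⟨z, hz, hpz, hnpz, hzx⟩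
      have hnzp := hnle hp' hz hpz
      have hnzx := hnle hx hz hxz
      have hnpz' : ¬ p ≤ z := fun hle => hnpz (lt_of_le_of_ne hle fun e => hpz.ne (e ▸ rfl))
      by_contra hnxp
      have hpx : p ≤ y ∧ ¬ x ≤ z := by
        rcases lt_trichotomy (L x) (L p) with hxp | hxp | hxp
        · refine ⟨((hL.lt_or_lt x hx y hy p hp' hxy hxp (hpz.trans_le hzy)).resolve_left
            fun hlt' => hnxp hlt'.le).le, fun hxz' => ?_⟩
          rcases hL.lt_or_lt x hx z hz p hp'
            (lt_of_le_of_ne hxz' fun e => hxz.ne (e ▸ rfl)) hxp hpz with h' | h'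
          exacts [hnxp h'.le, hnpz h']
        · exact absurd (hL.injOn hx hp' hxp).le hnxp
        · have hpx : p < x := by
            by_contra hnpx
            exact hUx ⟨x, hx, hxp, hnpx, le_rfl⟩
          exact ⟨(hpx.trans hxy).le, fun hxz' => hnpz (hpx.trans_le hxz')⟩
      obtain ⟨hpy, hnxz⟩ := hpx
      have hzy' : z ≤ y := by
        rcases hzy.eq_or_lt with e | hlt'
        · exact (hL.injOn hz hy e).le
        · exact ((hL.lt_or_lt x hx y hy z hz hxy hxz hlt').resolve_left fun h' => hnxz h'.le).le
      obtain ⟨w, hw, -⟩ := exists_isProperJoin hnxz hnzx hxy.le hzy'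
      obtain ⟨u, hu, -⟩ := exists_isProperJoin hnpz' hnzp hpy hzy'
      by_cases hpx : p ≤ x
      · have hpx' : L p < L x := hL.strictMonoOn hp' hx
          (lt_of_le_of_ne hpx fun e => hnxp e.ge)
        rcases joins_not_disjoint h ho hv₀ hw with e | e | e | e
        · exact (hx₀p.trans hpx').ne (e ▸ rfl)
        · exact (hx₀p.trans hpz).ne (e ▸ rfl)
        · exact hpx'.ne (e ▸ rfl)
        · exact hpz.ne (e ▸ rfl)
      · obtain ⟨d, hd, -⟩ := exists_isProperJoin hnxp hpx hxy.le hpy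
        exact not_triangle_joins h ho hd hw hu
  · obtain ⟨t, ht⟩ := exists_cut (A \ {m}) L (fun w => L p < L w) fun x _ y _ hx hy =>
      (not_lt.1 hx).trans_lt hy
    refine hL.insert_leaf hm hp hpm hlt ?_ ((ht p hp').2 (lt_irrefl _)) ?_ ?_
    · intro x hx e
      have := ht x hx
      rw [e] at this
      exact (em _).elim (fun hu => lt_irrefl _ (this.1 hu)) (fun hu => lt_irrefl _ (this.2 hu))
    · exact fun z hz hpz hzt => absurd ((ht z hz).1 hpz) hzt.asymm
    · intro x hx y hy hxy hxt hty
      have hxp : L x ≤ L p := not_lt.1 fun hu => lt_asymm hxt ((ht x hx).1 hu)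
      have hpy : L p < L y := by
        by_contra hu
        exact lt_asymm hty ((ht y hy).2 hu)
      rcases hxp.eq_or_lt with e | hxp
      · exact (hL.injOn hx hp' e).le
      rcases hL.lt_or_lt x hx y hy p hp' hxy hxp hpy with h' | h'
      · exact h'.le
      by_contra hnxp
      exact hcase ⟨x, hx, hxp, hnxp, y, hy, hxy.le, h'.le⟩

theorem exists_isNonseparating_Iic_of_joins {c v : α}
    (hc : ∀ x y w, IsProperJoin x y w → x = c ∨ y = c) :
    ∃ L, IsNonseparating (Set.Iic v) L ∧ ∀ b ≤ v, ¬ c ≤ b → L b < L c := by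
  refine exists_isNonseparating_Iic fun x hx y hy hxc hyc => ?_
  by_contra! hxy
  obtain ⟨w, hw, -⟩ := exists_isProperJoin hxy.1 hxy.2 hx hy
  exact (hc x y w hw).elim hxc hyc

theorem exists_isNonseparating_of_two_joins {A : Set α} {b b' c v v' : α}
    (hA : ∀ x, x ∈ A ↔ x ≤ v ∨ x ≤ v')
    (hc : ∀ x y w, IsProperJoin x y w → x = c ∨ y = c)
    (hbv : IsProperJoin c b v) (hbv' : IsProperJoin c b' v') (hvv' : ¬ v ≤ v') (hv'v : ¬ v' ≤ v)
    (hb : ∀ x w, IsProperJoin c x w → x = b ∨ x = b') :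
    ∃ L, IsNonseparating A L := by
  classical
  obtain ⟨hcb, hbc, hcv, hbv, hv⟩ := hbv
  obtain ⟨hcb', -, hcv', hbv', hv'⟩ := hbv'
  obtain ⟨L, hL, hLc⟩ := exists_isNonseparating_Iic_of_joins (v := v') hc
  have hbnv' : ¬ b ≤ v' := fun hle => hvv' (hv _ hcv' hle)
  have hb'nv : ¬ b' ≤ v := fun hle => hv'v (hv' _ hcv hle)
  have hbneb' : b ≠ b' := fun e => hb'nv (e ▸ hbv)
  have hbltv : b < v := lt_of_le_of_ne hbv fun e => hcb (e ▸ hcv)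
  have hbelow : ∀ x ≤ v, x = v ∨ x = b ∨ x ≤ c := by
    intro x hxv
    by_contra! hx
    obtain ⟨hxv', hxb, hxc⟩ := hx
    by_cases hcx : c ≤ x
    · by_cases hbx : b ≤ x
      · exact hxv' (hxv.antisymm (hv x hcx hbx))
      by_cases hxb' : x ≤ b
      · exact hcb (hcx.trans hxb')
      obtain ⟨w, hw, -⟩ := exists_isProperJoin hxb' hbx hxv hbv
      exact (hc _ _ _ hw).elim (fun e => hxc e.le) fun e => hbc e.le
    · obtain ⟨w, hw, -⟩ := exists_isProperJoin hcx hxc hcv hxv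
      exact (hb x w hw).elim hxb fun e => hb'nv (e ▸ hxv)
  have hmem : ∀ x ∈ A, x ≤ v' ∨ x = b ∨ x = v := by
    intro x hx
    rcases (hA x).1 hx with hx | hx
    · rcases hbelow x hx with e | e | e
      exacts [Or.inr (Or.inr e), Or.inr (Or.inl e), Or.inl (e.trans hcv')]
    · exact Or.inl hx
  have hltc : ∀ x < c, ∀ z ≤ v', L x < L z → x < z := by
    intro x hxc z hz hxz
    have hzx : ¬ z ≤ x := fun hzx =>
      (hL.strictMonoOn.monotoneOn (hzx.trans (hxc.le.trans hcv')) (hxc.le.trans hcv') hzx).not_gt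
        hxz
    have hxz' : x ≤ z := by
      by_contra hnxz
      obtain ⟨w, hw, -⟩ := exists_isProperJoin hnxz hzx (hxc.le.trans hcv') hz
      exact (hc _ _ _ hw).elim (fun e => hxc.ne e) fun e => hnxz (e ▸ hxc.le)
    exact lt_of_le_of_ne hxz' fun e => hzx e.ge
  have hgtc : ∀ z ≤ v', L c < L z → c < z := by
    intro z hz hcz
    have hcz' : c ≤ z := by
      by_contra hncz
      exact lt_asymm hcz (hLc z hz hncz)
    exact lt_of_le_of_ne hcz' fun e => hcz.ne (e ▸ rfl)
  obtain ⟨M, hM⟩ : ∃ M, ∀ x, L x < M := by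
    obtain ⟨M, hM⟩ := (Set.finite_range L).bddAbove
    exact ⟨M + 1, fun x => (hM ⟨x, rfl⟩).trans_lt (lt_add_one M)⟩
  let L' : α → ℝ := fun x => if x ≤ v' then L x else if x = b then M else M + 1
  have e1 : ∀ {x}, x ≤ v' → L' x = L x := fun hx => if_pos hx
  have e2 : L' b = M := by simp [L', hbnv']
  have e3 : L' v = M + 1 := by simp [L', hvv', hbltv.ne']
  have hnv : ∀ {x}, x ≤ v' → ¬ v ≤ x := fun hx hvx => hvv' (hvx.trans hx)
  have hnb : ∀ {x}, x ≤ v' → ¬ b ≤ x := fun hx hbx => hbnv' (hbx.trans hx)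
  refine ⟨L', ?_, ?_, ?_⟩
  · intro x hx y hy hxy
    rcases hmem x hx with hx | rfl | rfl <;> rcases hmem y hy with hy | rfl | rfl
    · rw [e1 hx, e1 hy] at hxy
      exact hL.injOn hx hy hxy
    · rw [e1 hx, e2] at hxy
      exact absurd hxy (hM x).ne
    · rw [e1 hx, e3] at hxy
      linarith [hM x]
    · rw [e1 hy, e2] at hxy
      exact absurd hxy (hM y).ne'
    · rfl
    · linarith
    · rw [e1 hy, e3] at hxy
      linarith [hM y]
    · linarith
    · rfl
  · intro x hx y hy hxy
    rcases hmem x hx with hx | rfl | rfl <;> rcases hmem y hy with hy | rfl | rfl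
    · rw [e1 hx, e1 hy]
      exact hL.strictMonoOn hx hy hxy
    · rw [e1 hx, e2]
      exact hM x
    · rw [e1 hx, e3]
      linarith [hM x]
    · exact absurd hxy.le (hnb hy)
    · exact absurd hxy (lt_irrefl _)
    · linarith
    · exact absurd hxy.le (hnv hy)
    · exact absurd hxy hbltv.asymm
    · exact absurd hxy (lt_irrefl _)
  · intro x hx y hy z hz hxy hxz hzy
    rcases hmem x hx with hx | rfl | rfl <;> rcases hmem y hy with hy | rfl | rfl <;>
      rcases hmem z hz with hz | rfl | rfl
    · rw [e1 hx, e1 hz] at hxz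
      rw [e1 hz, e1 hy] at hzy
      exact hL.lt_or_lt x hx y hy z hz hxy hxz hzy
    · rw [e1 hy] at hzy
      linarith [hM y]
    · rw [e1 hy] at hzy
      linarith [hM y]
    · rw [e1 hx, e1 hz] at hxz
      rcases hbelow x (hxy.le.trans hbv) with rfl | rfl | hxc
      · exact absurd hx hvv'
      · exact absurd hx hbnv'
      · exact Or.inl (hltc x (lt_of_le_of_ne hxc fun e => hcb (e ▸ hxy.le)) z hz hxz)
    · exact absurd hzy (lt_irrefl _)
    · linarith
    · rw [e1 hx, e1 hz] at hxz
      rcases hbelow x hxy.le with rfl | rfl | hxc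
      · exact absurd hx hvv'
      · exact absurd hx hbnv'
      · rcases hxc.eq_or_lt with rfl | hxc
        · exact Or.inl (hgtc z hz hxz)
        · exact Or.inl (hltc x hxc z hz hxz)
    · exact Or.inr hbltv
    · exact absurd hzy (lt_irrefl _)
    · exact absurd hxy.le (hnb hy)
    · exact absurd hxy.le (hnb hy)
    · exact absurd hxy.le (hnb hy)
    · exact absurd hxy (lt_irrefl _)
    · exact absurd hxy (lt_irrefl _)
    · exact absurd hxy (lt_irrefl _)
    · rw [e1 hz] at hxz
      linarith [hM z]
    · exact absurd hxz (lt_irrefl _)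
    · exact absurd hzy (lt_irrefl _)
    · exact absurd hxy.le (hnv hy)
    · exact absurd hxy.le (hnv hy)
    · exact absurd hxy.le (hnv hy)
    · exact absurd hxy hbltv.asymm
    · exact absurd hxy hbltv.asymm
    · exact absurd hxy hbltv.asymm
    · exact absurd hxy (lt_irrefl _)
    · exact absurd hxy (lt_irrefl _)
    · exact absurd hxy (lt_irrefl _)

theorem exists_isNonseparating (h : 25 * 2 ^ Fintype.card α ≤ 2 ^ 6 * numCong α)
    (ho : ∀ x, o ≤ x) (A : Set α) (hA : IsLowerSet A) : ∃ L, IsNonseparating A L := by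
  induction hn : A.ncard using Nat.strong_induction_on generalizing A with
  | _ n ih =>
  subst hn
  rcases A.eq_empty_or_nonempty with rfl | hne
  · exact ⟨0, by simp, by simp [StrictMonoOn], by simp⟩
  by_cases hleaf : ∃ m ∈ A, (∀ x ∈ A, ¬ m < x) ∧ ∃ p, p < m ∧ ∀ x, x < m → x ≤ p
  · obtain ⟨m, hmA, hm, p, hpm, hp⟩ := hleaf
    obtain ⟨L, hL⟩ := ih _ (Set.ncard_sdiff_singleton_lt_of_mem hmA A.toFinite) (A \ {m})
      (fun x y hyx hx => ⟨hA hyx hx.1, fun e => hm x hx.1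
        (lt_of_le_of_ne (e ▸ hyx) fun e' => hx.2 e'.symm)⟩) rfl
    exact exists_isNonseparating_of_leaf h ho hL hm (hA hpm.le hmA) hpm hp
  have hmax : ∀ x ∈ A, ∃ m ∈ A, x ≤ m ∧ ∀ y ∈ A, ¬ m < y := by
    intro x hx
    obtain ⟨m, hxm, hm⟩ := A.toFinite.exists_le_maximal hx
    exact ⟨m, hm.1, hxm, fun y hy hmy => hmy.not_ge (hm.2 hy hmy.le)⟩
  obtain ⟨a₀, ha₀⟩ := hne
  obtain ⟨v, hvA, -, hv⟩ := hmax a₀ ha₀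
  by_cases hmin : ∃ m ∈ A, (∀ x ∈ A, ¬ m < x) ∧ ∀ x, ¬ x < m
  · obtain ⟨m, -, hm, hm'⟩ := hmin
    have hmx : ∀ x ∈ A, x = m := by
      intro x hx
      have hle : m ≤ x := by
        by_contra hmx
        exact hm' (m ⊓ x) (lt_of_le_of_ne inf_le_left fun e => hmx (inf_eq_left.1 e))
      exact (hle.eq_of_not_lt (hm x hx)).symm
    refine ⟨0, fun x hx y hy _ => (hmx x hx).trans (hmx y hy).symm, fun x hx y hy hxy => ?_,
      fun x hx y hy z hz hxy => ?_⟩ <;>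
    exact absurd ((hmx x hx).trans (hmx y hy).symm) hxy.ne
  have hjoin : ∀ m ∈ A, (∀ x ∈ A, ¬ m < x) → ∃ a b, IsProperJoin a b m := by
    intro m hmA hm
    obtain ⟨q, hq⟩ : ∃ q, q < m := by
      by_contra! hq
      exact hmin ⟨m, hmA, hm, hq⟩
    obtain ⟨p, hp⟩ := (Set.toFinite (Set.Iio m)).exists_maximal ⟨q, hq⟩
    obtain ⟨y, hym, hyp⟩ : ∃ y, y < m ∧ ¬ y ≤ p := by
      by_contra! hy
      exact hleaf ⟨m, hmA, hm, p, hp.1, hy⟩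
    refine ⟨p, y, fun hpy => hyp (hp.2 hym hpy), hyp, le_of_lt hp.1, hym.le, fun w hpw hyw => ?_⟩
    by_contra hmw
    have hlt : m ⊓ w < m := lt_of_le_of_ne inf_le_left fun e => hmw (inf_eq_left.1 e)
    exact hyp ((le_inf hym.le hyw).trans (hp.2 hlt (le_inf (le_of_lt hp.1) hpw)))
  obtain ⟨a, b, hab⟩ := hjoin v hvA hv
  obtain ⟨c, hc⟩ := exists_mem_of_isProperJoin h ho hab
  have hjoin' : ∀ m ∈ A, (∀ x ∈ A, ¬ m < x) → ∃ b, IsProperJoin c b m := by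
    intro m hmA hm
    obtain ⟨a, b, hab⟩ := hjoin m hmA hm
    rcases hc _ _ _ hab with rfl | rfl
    exacts [⟨b, hab⟩, ⟨a, hab.symm⟩]
  by_cases hone : ∀ x ∈ A, x ≤ v
  · obtain ⟨L, hL, -⟩ := exists_isNonseparating_Iic_of_joins (v := v) hc
    have : A = Set.Iic v := Set.Subset.antisymm hone fun x hx => hA hx hvA
    exact ⟨L, this ▸ hL⟩
  push Not at hone
  obtain ⟨x, hx, hxv⟩ := hone
  obtain ⟨v', hv'A, hxv', hv'⟩ := hmax x hx
  have hv'v : ¬ v' ≤ v := fun hle => hxv (hxv'.trans hle)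
  have hvv' : ¬ v ≤ v' := fun hle => hv v' hv'A (lt_of_le_of_ne hle fun e => hv'v e.ge)
  obtain ⟨b, hb⟩ := hjoin' v hvA hv
  obtain ⟨b', hb'⟩ := hjoin' v' hv'A hv'
  have hN : ∀ x w, IsProperJoin c x w → x = b ∨ x = b' := fun x w hxw =>
    eq_or_eq_of_joins h ho hb hb' hxw fun e => hvv' e.le
  refine exists_isNonseparating_of_two_joins (fun z => ⟨fun hz => ?_, ?_⟩) hc hb hb' hvv' hv'v hN
  · obtain ⟨w, hwA, hzw, hw⟩ := hmax z hz
    obtain ⟨d, hd⟩ := hjoin' w hwA hw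
    rcases hN d w hd with rfl | rfl
    · exact Or.inl (hzw.trans (hd.2.2.2.2 v hb.2.2.1 hb.2.2.2.1))
    · exact Or.inr (hzw.trans (hd.2.2.2.2 v' hb'.2.2.1 hb'.2.2.2.1))
  · rintro (hz | hz)
    exacts [hA hz hvA, hA hz hv'A]

end ManyCongruences

/-- A finite meet-semilattice with at least 25·2^(n-6) congruences is planar
(stated multiplied through by 2^6). -/
theorem manyCong_implies_planar {α : Type*} [SemilatticeInf α] [Fintype α]
    (h : 25 * 2 ^ Fintype.card α ≤ 2 ^ 6 * numCong α) :
    IsPlanarOrder α := by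
  obtain ⟨L, hL⟩ : ∃ L : α → ℝ, IsNonseparating Set.univ L := by
    cases isEmpty_or_nonempty α
    · exact ⟨0, fun x => isEmptyElim x, fun x => isEmptyElim x, fun x => isEmptyElim x⟩
    · exact exists_isNonseparating h (o := Finset.univ.inf' Finset.univ_nonempty id)
        (fun x => Finset.inf'_le id (Finset.mem_univ x)) Set.univ isLowerSet_univ
  obtain ⟨g, hg, hLg⟩ := exists_realizer hL
  exact isPlanarOrder_of_realizer (fun x y hxy => hL.injOn trivial trivial hxy)
    (fun x y hxy => hL.strictMonoOn trivial trivial hxy) hg hLg
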